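/- Let F be the 2×2 matrix [[1,0],[1,1]] over F₂, let F^{⊗m} denote its m-fold Kronecker power, let B_m be the 2^m×2^m bit-reversal permutation matrix (the permutation matrix sending index with binary expansion (i_{m−1},…,i₀) to the index with binary expansion (i₀,…,i_{m−1})), and set A_m = B_m·F^{⊗m}. Let A be the 24×24 block-diagonal matrix diag(A₄, A₃) over F₂. Let V be the 12×24 matrix over F₂ whose row i (for i = 1,…,12) has entry 1 exactly in the following 0-indexed columns: row 1: {0}; row 2: {1}; row 3: {2}; row 4: {4}; row 5: {8}; row 6: {16}; row 7: {3, 17}; row 8: {5, 18}; row 9: {6, 9, 17, 18, 19}; row 10: {9, 20}; row 11: {10, 17, 18, 21}; row 12: {12, 17, 22}. Then {u·A : u ∈ F₂^24, u·Vᵀ = 0} = C_G, the extended Golay code; that is, the extended Golay code is a chained polar subcode with mixed polarizing transformation A and constraint matrix V. -/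

import Mathlib

open Matrix Kronecker

/-- The 2×2 polarization kernel `F = [[1,0],[1,1]]` over `F₂`. -/
def Fker : Matrix (Fin 2) (Fin 2) (ZMod 2) := !![1,0;1,1]

/-- The `m`-fold Kronecker power `F^{⊗m}` of the kernel, as a `2^m × 2^m` matrix
(the left factor carries the high-order bits of the index). -/
def kronPow : (m : ℕ) → Matrix (Fin (2 ^ m)) (Fin (2 ^ m)) (ZMod 2)
  | 0 => 1
  | m + 1 =>
    Matrix.reindex (finProdFinEquiv.trans (finCongr (by ring)))
      (finProdFinEquiv.trans (finCongr (by ring))) (Fker ⊗ₖ kronPow m)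

/-- Reversal of the `m` low-order bits of a natural number: the index with binary
expansion `(i_{m-1},…,i₀)` is sent to the one with expansion `(i₀,…,i_{m-1})`. -/
def bitrev : ℕ → ℕ → ℕ
  | 0, _ => 0
  | m + 1, i => bitrev m (i / 2) + i % 2 * 2 ^ m

/-- The `2^m × 2^m` bit-reversal permutation matrix `B_m`. -/
def Bm (m : ℕ) : Matrix (Fin (2 ^ m)) (Fin (2 ^ m)) (ZMod 2) :=
  Matrix.of fun i j => if bitrev m (i : ℕ) = (j : ℕ) then 1 else 0

/-- The polarizing matrix `A_m = B_m · F^{⊗m}`. -/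
def Am (m : ℕ) : Matrix (Fin (2 ^ m)) (Fin (2 ^ m)) (ZMod 2) := Bm m * kronPow m

/-- The mixed polarizing transformation `A = diag(A₄, A₃)`, a `24×24` matrix. -/
def Achain : Matrix (Fin 24) (Fin 24) (ZMod 2) :=
  Matrix.reindex finSumFinEquiv finSumFinEquiv (Matrix.fromBlocks (Am 4) 0 0 (Am 3))

/-- The `12×24` constraint matrix `V` of the chained polar subcode representation. -/
def Vmat : Matrix (Fin 12) (Fin 24) (ZMod 2) := Matrix.of
  ![![1,0,0,0,0,0,0,0,0,0,0,0,0,0,0,0,0,0,0,0,0,0,0,0],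
   ![0,1,0,0,0,0,0,0,0,0,0,0,0,0,0,0,0,0,0,0,0,0,0,0],
   ![0,0,1,0,0,0,0,0,0,0,0,0,0,0,0,0,0,0,0,0,0,0,0,0],
   ![0,0,0,0,1,0,0,0,0,0,0,0,0,0,0,0,0,0,0,0,0,0,0,0],
   ![0,0,0,0,0,0,0,0,1,0,0,0,0,0,0,0,0,0,0,0,0,0,0,0],
   ![0,0,0,0,0,0,0,0,0,0,0,0,0,0,0,0,1,0,0,0,0,0,0,0],
   ![0,0,0,1,0,0,0,0,0,0,0,0,0,0,0,0,0,1,0,0,0,0,0,0],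
   ![0,0,0,0,0,1,0,0,0,0,0,0,0,0,0,0,0,0,1,0,0,0,0,0],
   ![0,0,0,0,0,0,1,0,0,1,0,0,0,0,0,0,0,1,1,1,0,0,0,0],
   ![0,0,0,0,0,0,0,0,0,1,0,0,0,0,0,0,0,0,0,0,1,0,0,0],
   ![0,0,0,0,0,0,0,0,0,0,1,0,0,0,0,0,0,1,1,0,0,1,0,0],
   ![0,0,0,0,0,0,0,0,0,0,0,0,1,0,0,0,0,1,0,0,0,0,1,0]]

/-- The vectors `a₁,…,a₄ ∈ F₂⁸`. -/
def av : Fin 4 → (Fin 8 → ZMod 2) :=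
  ![![1,1,1,1,0,0,0,0], ![1,0,1,0,1,0,1,0], ![1,0,0,1,1,0,0,1], ![1,0,0,1,0,1,1,0]]

/-- The vectors `b₁,…,b₄ ∈ F₂⁸`. -/
def bv : Fin 4 → (Fin 8 → ZMod 2) :=
  ![![1,1,0,1,1,0,0,0], ![1,0,1,1,0,0,1,0], ![1,0,0,0,1,0,1,1], ![1,0,0,1,0,1,0,1]]

/-- The rows of the `12×24` generator matrix `G` of the extended Golay code:
`(aᵢ, 0, aᵢ)`, `(0, aᵢ, aᵢ)` and `(bᵢ, bᵢ, bᵢ)` for `i = 1,…,4`. -/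
def golayRows : Fin 12 → (Fin 24 → ZMod 2) :=
  Fin.append (Fin.append
    (fun i : Fin 4 => Fin.append (Fin.append (av i) (0 : Fin 8 → ZMod 2)) (av i))
    (fun i : Fin 4 => Fin.append (Fin.append (0 : Fin 8 → ZMod 2) (av i)) (av i)))
    (fun i : Fin 4 => Fin.append (Fin.append (bv i) (bv i)) (bv i))

/-- The extended Golay code `C_G`, the row space of `G`. -/
def CG : Submodule (ZMod 2) (Fin 24 → ZMod 2) := Submodule.span (ZMod 2) (Set.range golayRows)

/-- Coefficients expressing the rows of `A`, modulo the constraints, through the rows of `G`. -/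
def Kmat : Matrix (Fin 24) (Fin 12) (ZMod 2) := Matrix.of
  ![![0,0,0,0,0,0,0,0,0,0,0,0],
   ![0,0,0,0,0,0,0,0,0,0,0,0],
   ![0,0,0,0,0,0,0,0,0,0,0,0],
   ![0,0,0,0,0,0,0,0,0,0,0,0],
   ![0,0,0,0,0,0,0,0,0,0,0,0],
   ![0,0,0,0,0,0,0,0,0,0,0,0],
   ![0,0,0,0,0,0,0,0,0,0,0,0],
   ![0,1,0,0,0,1,0,0,0,0,0,0],
   ![0,0,0,0,0,0,0,0,0,0,0,0],
   ![0,0,0,0,0,1,0,0,1,1,0,0],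
   ![0,0,0,0,0,0,0,0,0,0,0,0],
   ![1,1,0,1,1,1,0,1,0,0,0,0],
   ![0,0,0,0,0,0,0,0,0,0,0,0],
   ![1,0,0,0,1,0,0,0,0,0,0,0],
   ![0,0,0,0,1,0,1,1,1,1,0,1],
   ![1,0,1,1,1,0,1,1,0,0,0,0],
   ![0,0,0,0,0,0,0,0,0,0,0,0],
   ![0,0,0,0,0,0,0,1,0,0,1,1],
   ![0,0,0,0,1,0,0,1,1,0,1,1],
   ![0,1,0,0,0,0,0,0,0,0,0,0],
   ![0,0,0,0,0,0,0,0,0,0,0,0],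
   ![1,1,0,1,0,0,0,0,0,0,0,0],
   ![1,0,0,0,0,0,0,0,0,0,0,0],
   ![1,0,1,1,1,0,1,1,1,1,0,1]]

/-- The pivot columns of `V`. -/
def pivV : Fin 12 → Fin 24 := ![0,1,2,4,8,16,3,5,6,20,10,12]

/-- The matrix `A` written out. -/
def Aexp : Matrix (Fin 24) (Fin 24) (ZMod 2) := Matrix.of
  ![![1,0,0,0,0,0,0,0,0,0,0,0,0,0,0,0,0,0,0,0,0,0,0,0],
   ![1,0,0,0,0,0,0,0,1,0,0,0,0,0,0,0,0,0,0,0,0,0,0,0],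
   ![1,0,0,0,1,0,0,0,0,0,0,0,0,0,0,0,0,0,0,0,0,0,0,0],
   ![1,0,0,0,1,0,0,0,1,0,0,0,1,0,0,0,0,0,0,0,0,0,0,0],
   ![1,0,1,0,0,0,0,0,0,0,0,0,0,0,0,0,0,0,0,0,0,0,0,0],
   ![1,0,1,0,0,0,0,0,1,0,1,0,0,0,0,0,0,0,0,0,0,0,0,0],
   ![1,0,1,0,1,0,1,0,0,0,0,0,0,0,0,0,0,0,0,0,0,0,0,0],
   ![1,0,1,0,1,0,1,0,1,0,1,0,1,0,1,0,0,0,0,0,0,0,0,0],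
   ![1,1,0,0,0,0,0,0,0,0,0,0,0,0,0,0,0,0,0,0,0,0,0,0],
   ![1,1,0,0,0,0,0,0,1,1,0,0,0,0,0,0,0,0,0,0,0,0,0,0],
   ![1,1,0,0,1,1,0,0,0,0,0,0,0,0,0,0,0,0,0,0,0,0,0,0],
   ![1,1,0,0,1,1,0,0,1,1,0,0,1,1,0,0,0,0,0,0,0,0,0,0],
   ![1,1,1,1,0,0,0,0,0,0,0,0,0,0,0,0,0,0,0,0,0,0,0,0],
   ![1,1,1,1,0,0,0,0,1,1,1,1,0,0,0,0,0,0,0,0,0,0,0,0],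
   ![1,1,1,1,1,1,1,1,0,0,0,0,0,0,0,0,0,0,0,0,0,0,0,0],
   ![1,1,1,1,1,1,1,1,1,1,1,1,1,1,1,1,0,0,0,0,0,0,0,0],
   ![0,0,0,0,0,0,0,0,0,0,0,0,0,0,0,0,1,0,0,0,0,0,0,0],
   ![0,0,0,0,0,0,0,0,0,0,0,0,0,0,0,0,1,0,0,0,1,0,0,0],
   ![0,0,0,0,0,0,0,0,0,0,0,0,0,0,0,0,1,0,1,0,0,0,0,0],
   ![0,0,0,0,0,0,0,0,0,0,0,0,0,0,0,0,1,0,1,0,1,0,1,0],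
   ![0,0,0,0,0,0,0,0,0,0,0,0,0,0,0,0,1,1,0,0,0,0,0,0],
   ![0,0,0,0,0,0,0,0,0,0,0,0,0,0,0,0,1,1,0,0,1,1,0,0],
   ![0,0,0,0,0,0,0,0,0,0,0,0,0,0,0,0,1,1,1,1,0,0,0,0],
   ![0,0,0,0,0,0,0,0,0,0,0,0,0,0,0,0,1,1,1,1,1,1,1,1]]

/-- The generator matrix as a matrix. -/
def Gmat : Matrix (Fin 12) (Fin 24) (ZMod 2) := Matrix.of golayRows

set_option maxRecDepth 100000 in
set_option maxHeartbeats 4000000 in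
theorem Achain_eq : Achain = Aexp := by
  decide +kernel

set_option maxRecDepth 100000 in
set_option maxHeartbeats 4000000 in
theorem Aexp_sq : Aexp * Aexp = 1 := by
  decide +kernel

set_option maxRecDepth 100000 in
set_option maxHeartbeats 4000000 in
theorem G_A_V : Gmat * (Aexp * Vmatᵀ) = 0 := by
  decide +kernel

set_option maxRecDepth 100000 in
set_option maxHeartbeats 4000000 in
theorem A_decomp : Aexp = Vmatᵀ * Aexp.submatrix pivV id + Kmat * Gmat := by
  decide +kernel

/-- The extended Golay code is a chained polar subcode with mixed polarizing
transformation `A = diag(A₄, A₃)` and constraint matrix `V`: the set of vectors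
`u·A` with `u·Vᵀ = 0` is exactly `C_G`. -/
theorem golay_is_chained_polar_subcode :
    {c : Fin 24 → ZMod 2 | ∃ u : Fin 24 → ZMod 2,
        Matrix.vecMul u Vmatᵀ = 0 ∧ c = Matrix.vecMul u Achain} =
      (CG : Set (Fin 24 → ZMod 2)) := by

  have hCG : ∀ c, c ∈ CG ↔ ∃ y : Fin 12 → ZMod 2, y ᵥ* Gmat = c := by
    intro c
    have h : CG = LinearMap.range Gmat.vecMulLinear := by
      rw [_root_.range_vecMulLinear]
      rfl
    rw [h]
    simp
  ext c
  rw [Set.mem_ofPred_eq, SetLike.mem_coe, hCG, Achain_eq]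
  constructor
  · rintro ⟨u, hu, rfl⟩
    refine ⟨u ᵥ* Kmat, ?_⟩
    conv_rhs => rw [A_decomp]
    rw [Matrix.vecMul_add, ← Matrix.vecMul_vecMul, hu, Matrix.zero_vecMul, zero_add,
      Matrix.vecMul_vecMul]
  · rintro ⟨y, rfl⟩
    refine ⟨y ᵥ* Gmat ᵥ* Aexp, ?_, ?_⟩
    · rw [Matrix.vecMul_vecMul, Matrix.vecMul_vecMul, G_A_V, Matrix.vecMul_zero]
    · rw [Matrix.vecMul_vecMul, Aexp_sq, Matrix.vecMul_one]
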